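/- An instance (G,b,w) of Stable Fixtures with Payments has a stable solution if and only if the maximum weight of a b-matching in G equals the maximum weight of a half-b-matching in G. -/

import Mathlib

open scoped Classical
open Finset

namespace MatchingGames

variable {V : Type*}

/-- `M` is a matching of the graph `G`: a set of edges of `G` that are pairwise
vertex-disjoint. -/
def IsMatching (G : SimpleGraph V) (M : Finset (Sym2 V)) : Prop :=
  (∀ e ∈ M, e ∈ G.edgeSet) ∧
    ∀ e ∈ M, ∀ f ∈ M, e ≠ f → ∀ v : V, v ∈ e → v ∉ f

/-- every endpoint of every edge of `M` belongs to the coalition `S`, i.e. `M` is a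
set of edges of the induced subgraph `G[S]`. -/
def EdgesIn (S : Finset V) (M : Finset (Sym2 V)) : Prop :=
  ∀ e ∈ M, ∀ v : V, v ∈ e → v ∈ S

/-- the weight `w(M)` of a set of edges `M`. -/
noncomputable def mWeight (w : Sym2 V → ℝ) (M : Finset (Sym2 V)) : ℝ :=
  ∑ e ∈ M, w e

/-- the value `v(S)` of a coalition `S` in the matching game on `(G,w)`:
the maximum weight of a matching of the induced subgraph `G[S]`. -/
noncomputable def matchVal (G : SimpleGraph V) (w : Sym2 V → ℝ) (S : Finset V) : ℝ :=
  sSup {t | ∃ M : Finset (Sym2 V), IsMatching G M ∧ EdgesIn S M ∧ t = mWeight w M}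

/-- `x` is a core allocation of the cooperative game with value function `v`:
`x(N) = v(N)` and `x(S) ≥ v(S)` for every coalition `S`. -/
def InCore [Fintype V] (v : Finset V → ℝ) (x : V → ℝ) : Prop :=
  (∑ i, x i) = v Finset.univ ∧ ∀ S : Finset V, v S ≤ ∑ i ∈ S, x i

/-- `M` is a `b`-matching of `G`: a set of edges of `G` such that every vertex `i` is
incident to at most `b i` edges of `M`. -/
def IsBMatching [DecidableEq V] (G : SimpleGraph V) (b : V → ℕ)
    (M : Finset (Sym2 V)) : Prop :=
  (∀ e ∈ M, e ∈ G.edgeSet) ∧ ∀ i : V, (M.filter (fun e => i ∈ e)).card ≤ b i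

/-- the value `v(S)` of a coalition `S` in the `b`-matching game on `(G,b,w)`:
the maximum weight of a `b`-matching of the induced subgraph `G[S]`. -/
noncomputable def bVal [DecidableEq V] (G : SimpleGraph V) (b : V → ℕ)
    (w : Sym2 V → ℝ) (S : Finset V) : ℝ :=
  sSup {t | ∃ M : Finset (Sym2 V), IsBMatching G b M ∧ EdgesIn S M ∧ t = mWeight w M}

/-- `(M,p)` is a solution for the instance `(G,b,w)`: `M` is a `b`-matching of `G`,
matched pairs split the weight of their edge into two nonnegative pay-offs, and all
other pay-offs are zero. -/
def IsBSolution [DecidableEq V] (G : SimpleGraph V) (b : V → ℕ) (w : Sym2 V → ℝ)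
    (M : Finset (Sym2 V)) (p : V → V → ℝ) : Prop :=
  IsBMatching G b M ∧
    (∀ i j : V, s(i, j) ∈ M → 0 ≤ p i j ∧ 0 ≤ p j i ∧ p i j + p j i = w s(i, j)) ∧
    ∀ i j : V, s(i, j) ∉ M → p i j = 0

/-- the total pay-off vector `p^t`. -/
noncomputable def totalPayoff [Fintype V] (p : V → V → ℝ) (i : V) : ℝ := ∑ j, p i j

/-- the utility `u_p(i)`: the `b i`-th largest pay-off `p i j` over the edges `ij` of
`G` (taken as `0` if `i` has fewer than `b i` incident edges; note that in Lean
`sSup ∅ = 0` for real numbers). -/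
noncomputable def utility [Fintype V] (G : SimpleGraph V) (b : V → ℕ)
    (p : V → V → ℝ) (i : V) : ℝ :=
  sSup {t : ℝ | b i ≤ (Finset.univ.filter (fun j : V => G.Adj i j ∧ t ≤ p i j)).card}

/-- a solution `(M,p)` for `(G,b,w)` is stable if no pair `{i,j}` with `ij ∈ E \ M`
satisfies `u_p(i) + u_p(j) < w(ij)`. -/
def IsBStable [Fintype V] [DecidableEq V] (G : SimpleGraph V) (b : V → ℕ)
    (w : Sym2 V → ℝ) (M : Finset (Sym2 V)) (p : V → V → ℝ) : Prop :=
  IsBSolution G b w M p ∧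
    ∀ i j : V, G.Adj i j → s(i, j) ∉ M →
      w s(i, j) ≤ utility G b p i + utility G b p j

/-- `f` is a fractional `b`-matching of `G`: it is supported on the edges of `G`, takes
values in `[0,1]`, and the values on the edges at any vertex `i` sum to at most `b i`. -/
def IsFractionalBMatching [Fintype V] [DecidableEq V] (G : SimpleGraph V) (b : V → ℕ)
    (f : Sym2 V → ℝ) : Prop :=
  (∀ e, e ∉ G.edgeSet → f e = 0) ∧ (∀ e, 0 ≤ f e ∧ f e ≤ 1) ∧
    ∀ i : V, (∑ e ∈ Finset.univ.filter (fun e : Sym2 V => i ∈ e), f e) ≤ (b i : ℝ)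

/-- a half-`b`-matching is a fractional `b`-matching taking values in `{0, 1/2, 1}`. -/
def IsHalfBMatching [Fintype V] [DecidableEq V] (G : SimpleGraph V) (b : V → ℕ)
    (f : Sym2 V → ℝ) : Prop :=
  IsFractionalBMatching G b f ∧ ∀ e, f e = 0 ∨ f e = 1 / 2 ∨ f e = 1

/-- the weight `w(f) = Σ_e w(e) f(e)` of a fractional `b`-matching `f`. -/
noncomputable def fWeight [Fintype V] [DecidableEq V] (w f : Sym2 V → ℝ) : ℝ :=
  ∑ e : Sym2 V, w e * f e

/-- total cost of the consecutive arcs of a list of nodes. -/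
noncomputable def lcost {N : Type*} (c : N → N → ℝ) : List N → ℝ
  | [] => 0
  | [_] => 0
  | x :: y :: l => c x y + lcost c (y :: l)

theorem lcost_append {N : Type*} (c : N → N → ℝ) (x : N) (r : List N) :
    ∀ q : List N, lcost c (q ++ x :: r) = lcost c (q ++ [x]) + lcost c (x :: r)
  | [] => by simp [lcost]
  | [a] => by simp [lcost]
  | a :: a' :: q => by
    have := lcost_append c x r (a' :: q)
    simp only [List.cons_append, lcost] at this ⊢
    rw [this]; ring

theorem lcost_zip {N : Type*} (c : N → N → ℝ) (z : N) :
    ∀ (a : N) (q : List N),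
      lcost c (a :: (q ++ [z])) = (List.zipWith c (a :: q) (q ++ [z])).sum
  | a, [] => by simp [lcost]
  | a, a' :: q => by
    have := lcost_zip c z a' q
    simp only [List.cons_append, lcost, List.zipWith_cons_cons, List.sum_cons] at this ⊢
    rw [this]

theorem chain_forall {N : Type*} (R : N → N → Prop) (z : N) :
    ∀ (a : N) (q : List N),
      List.IsChain R (a :: (q ++ [z])) → List.Forall₂ R (a :: q) (q ++ [z])
  | a, [], h => by simpa using h
  | a, a' :: q, h => by
    simp only [List.cons_append, List.isChain_cons_cons] at h
    exact List.Forall₂.cons h.1 (chain_forall R z a' q h.2)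

theorem map_formPerm {N : Type*} (x : N) (q : List N) (h : (x :: q).Nodup) :
    (x :: q).map (x :: q).formPerm = q ++ [x] := by
  have : q ++ [x] = (x :: q).rotate 1 := by simp
  rw [this]
  apply List.ext_getElem
  · simp
  · intro i h1 h2
    rw [List.getElem_rotate, List.getElem_map, List.formPerm_apply_getElem _ h]

theorem exists_potential {N : Type*} [Fintype N] (R : N → N → Prop) (c : N → N → ℝ)
    (hR : ∀ x, R x x) (hc : ∀ x, c x x = 0)
    (h : ∀ σ : Equiv.Perm N, (∀ x, R x (σ x)) → 0 ≤ ∑ x, c x (σ x)) :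
    ∃ π : N → ℝ, ∀ x y, R x y → π y ≤ π x + c x y := by
  have hcyc : ∀ x q, (x :: q).Nodup → List.IsChain R (x :: (q ++ [x])) →
      0 ≤ lcost c (x :: (q ++ [x])) := by
    intro x q hn hch
    have hm := map_formPerm x q hn
    have hf := chain_forall R x x q hch
    have hs := lcost_zip c x x q
    rw [← hm] at hf hs
    set σ := (x :: q).formPerm with hσ
    have h0 := h σ (by
      intro z
      by_cases hz : z ∈ x :: q
      · rw [List.forall₂_map_right_iff, List.forall₂_same] at hf
        exact hf z hz
      · rw [hσ, List.formPerm_apply_of_notMem hz]; exact hR z)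
    have e1 : (List.zipWith c (x :: q) (List.map σ (x :: q))).sum
        = ((x :: q).map (fun z => c z (σ z))).sum := by
      congr 1
      rw [List.zipWith_map_right, List.zipWith_self]
    have hs' : lcost c (x :: (q ++ [x])) = ((x :: q).map (fun z => c z (σ z))).sum := by
      rw [← e1, ← hs, hm]
    rw [hs', ← List.sum_toFinset _ hn]
    rw [← Finset.sum_subset (Finset.subset_univ (x :: q).toFinset)] at h0
    · exact h0
    · intro z _ hz
      have : z ∉ x :: q := by simpa using hz
      rw [hσ, List.formPerm_apply_of_notMem this]; exact hc z
  have hex : ∀ x : N, ∃ l : List N, ((x :: l).Nodup ∧ List.IsChain R (x :: l)) ∧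
      ∀ l' : List N, ((x :: l').Nodup ∧ List.IsChain R (x :: l')) →
        lcost c (x :: l) ≤ lcost c (x :: l') := by
    intro x
    have hfin : {l : List N | (x :: l).Nodup ∧ List.IsChain R (x :: l)}.Finite := by
      have : {l : List N | l.Nodup}.Finite := by
        have : Finite {l : List N // l.Nodup} := inferInstance
        exact this
      refine this.subset ?_
      intro l hl
      exact (List.nodup_cons.1 hl.1).2
    obtain ⟨l, hl, hmin⟩ := Set.exists_min_image _ (fun l => lcost c (x :: l)) hfin
      ⟨[], by simp⟩
    exact ⟨l, hl, hmin⟩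
  choose P hP hmin using hex
  refine ⟨fun x => - lcost c (x :: P x), fun x y hxy => ?_⟩
  suffices lcost c (x :: P x) ≤ c x y + lcost c (y :: P y) by linarith
  by_cases hx : x ∈ y :: P y
  · obtain ⟨q, r, hqr⟩ := List.append_of_mem hx
    have hn := (hP y).1
    have hch := (hP y).2
    have hch2 : List.IsChain R (x :: (y :: P y)) := List.isChain_cons_cons.2 ⟨hxy, hch⟩
    have e : c x y + lcost c (y :: P y) = lcost c (x :: (y :: P y)) := rfl
    rw [e]
    rw [hqr] at hn hch hch2 ⊢
    have e2 := lcost_append c x r (x :: q)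
    rw [List.cons_append, List.cons_append] at e2
    rw [e2]
    have hn1 : (x :: r).Nodup := (List.nodup_append.1 hn).2.1
    have hc1 : List.IsChain R (x :: r) := hch.right_of_append
    have hn2 : (x :: q).Nodup := by
      have := List.nodup_middle.1 hn
      rw [← List.cons_append] at this
      exact (List.nodup_append.1 this).1
    have hc2 : List.IsChain R (x :: (q ++ [x])) := by
      have : x :: (q ++ x :: r) = (x :: (q ++ [x])) ++ r := by simp
      rw [this] at hch2
      exact hch2.left_of_append
    have := hcyc x q hn2 hc2
    have := hmin x r ⟨hn1, hc1⟩
    linarith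
  · exact hmin x (y :: P y) ⟨List.nodup_cons.2 ⟨hx, (hP y).1⟩,
      List.isChain_cons_cons.2 ⟨hxy, (hP y).2⟩⟩

theorem sum_incident [Fintype V] [DecidableEq V] (g : Sym2 V → ℝ) (i : V) :
    ∑ e ∈ Finset.univ.filter (fun e : Sym2 V => i ∈ e), g e = ∑ j, g s(i, j) := by
  symm
  apply Finset.sum_bij (fun j _ => s(i, j))
  · intro j _; simp
  · intro j _ k _ h; exact Sym2.congr_right.1 h
  · intro e he
    simp only [Finset.mem_filter, Finset.mem_univ, true_and] at he
    obtain ⟨j, rfl⟩ := he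
    exact ⟨j, Finset.mem_univ _, rfl⟩
  · intro j _; rfl

theorem sum_double [Fintype V] [DecidableEq V] (g : Sym2 V → ℝ) (hg : ∀ i, g s(i, i) = 0) :
    ∑ i, ∑ j, g s(i, j) = 2 * ∑ e, g e := by
  simp_rw [← sum_incident, Finset.sum_filter]
  rw [Finset.sum_comm, Finset.mul_sum]
  refine Finset.sum_congr rfl fun e _ => ?_
  induction e with
  | _ a b =>
    by_cases hab : a = b
    · subst hab; simp [hg]
    · rw [← Finset.sum_filter, Finset.sum_const]
      have : (Finset.univ.filter (fun x : V => x ∈ s(a, b))) = {a, b} := by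
        ext x; simp
      rw [this, Finset.card_pair hab]; simp

/-- indicator of a set of edges. -/
noncomputable def eind (M : Finset (Sym2 V)) (e : Sym2 V) : ℝ := if e ∈ M then 1 else 0

/-- indicator of a set of edges, as a function of two endpoints. -/
noncomputable def ind (M : Finset (Sym2 V)) (i j : V) : ℝ := eind M s(i, j)

theorem ind_mem {M : Finset (Sym2 V)} {i j : V} (h : s(i, j) ∈ M) : ind M i j = 1 := by
  simp [ind, eind, h]

theorem ind_not_mem {M : Finset (Sym2 V)} {i j : V} (h : s(i, j) ∉ M) : ind M i j = 0 := by
  simp [ind, eind, h]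

theorem ind_comm (M : Finset (Sym2 V)) (i j : V) : ind M i j = ind M j i := by
  simp [ind, Sym2.eq_swap]

theorem sum_ind [Fintype V] [DecidableEq V] (M : Finset (Sym2 V)) (i : V) :
    ∑ j, ind M i j = ((M.filter (fun e => i ∈ e)).card : ℝ) := by
  have := sum_incident (eind M) i
  unfold ind
  rw [← this, Finset.sum_filter, Finset.card_filter]
  push_cast
  symm
  apply Finset.sum_subset_zero_on_sdiff (Finset.subset_univ M)
  · intro e he
    have : e ∉ M := by simpa using he
    simp [eind, this]
  · intro e he
    by_cases hi : i ∈ e <;> simp [eind, he, hi]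

theorem sum_mWeight [Fintype V] [DecidableEq V] (G : SimpleGraph V) (M : Finset (Sym2 V))
    (hM : ∀ e ∈ M, e ∈ G.edgeSet) (w : Sym2 V → ℝ) :
    ∑ i, ∑ j, w s(i, j) * ind M i j = 2 * mWeight w M := by
  have := sum_double (fun e => w e * eind M e) (by
    intro i
    have : s(i, i) ∉ M := fun h => by simpa using hM _ h
    simp [eind, this])
  unfold ind
  rw [this]; congr 1
  simp [mWeight, eind]

theorem sum_fWeight [Fintype V] [DecidableEq V] (G : SimpleGraph V) (f : Sym2 V → ℝ)
    (hf : ∀ e, e ∉ G.edgeSet → f e = 0) (w : Sym2 V → ℝ) :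
    ∑ i, ∑ j, w s(i, j) * f s(i, j) = 2 * fWeight w f :=
  sum_double (fun e => w e * f e) (by intro i; rw [hf _ (by simp), mul_zero])

section Util
set_option linter.unusedSectionVars false
variable [Fintype V] [DecidableEq V] {G : SimpleGraph V} {b : V → ℕ}
  {w : Sym2 V → ℝ} {M : Finset (Sym2 V)} {p : V → V → ℝ}

theorem sol_nonneg (h : IsBSolution G b w M p) (i j : V) : 0 ≤ p i j := by
  by_cases hm : s(i, j) ∈ M
  · exact (h.2.1 i j hm).1
  · rw [h.2.2 i j hm]

theorem sum_ind_card (i : V) :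
    ∑ j, ind M i j = ((Finset.univ.filter (fun j => s(i, j) ∈ M)).card : ℝ) := by
  rw [Finset.card_filter]
  push_cast
  refine Finset.sum_congr rfl fun j _ => ?_
  by_cases h : s(i, j) ∈ M <;> simp [ind, eind, h]

theorem util_bdd (hb : ∀ i, 0 < b i) (h : IsBSolution G b w M p) (i : V) :
    BddAbove {t : ℝ | b i ≤ (Finset.univ.filter (fun j : V => G.Adj i j ∧ t ≤ p i j)).card} := by
  refine ⟨∑ j, p i j, ?_⟩
  intro t ht
  have : 0 < (Finset.univ.filter (fun j : V => G.Adj i j ∧ t ≤ p i j)).card :=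
    lt_of_lt_of_le (hb i) ht
  obtain ⟨j, hj⟩ := Finset.card_pos.1 this
  simp only [Finset.mem_filter] at hj
  exact hj.2.2.trans (Finset.single_le_sum (fun k _ => sol_nonneg h i k) (Finset.mem_univ j))

theorem util_nonneg (hb : ∀ i, 0 < b i) (h : IsBSolution G b w M p) (i : V) :
    0 ≤ utility G b p i := by
  unfold utility
  rcases Set.eq_empty_or_nonempty {t : ℝ | b i ≤
    (Finset.univ.filter (fun j : V => G.Adj i j ∧ t ≤ p i j)).card} with he | ⟨t, ht⟩
  · rw [he]; simp
  · apply le_csSup (util_bdd hb h i)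
    refine le_trans (show b i ≤ _ from ht) (Finset.card_le_card ?_)
    intro j hj
    simp only [Finset.mem_filter, Finset.mem_univ, true_and] at hj ⊢
    exact ⟨hj.1, sol_nonneg h i j⟩

theorem util_pos_aux (h : IsBSolution G b w M p) (i : V) (t : ℝ) (ht0 : 0 < t)
    (ht : b i ≤ (Finset.univ.filter (fun j : V => G.Adj i j ∧ t ≤ p i j)).card) :
    ∑ j, ind M i j = b i ∧ ∀ j, s(i, j) ∈ M → t ≤ p i j := by
  have hsub : (Finset.univ.filter (fun j : V => G.Adj i j ∧ t ≤ p i j)) ⊆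
      (Finset.univ.filter (fun j => s(i, j) ∈ M)) := by
    intro j hj
    simp only [Finset.mem_filter, Finset.mem_univ, true_and] at hj ⊢
    by_contra hm
    have := h.2.2 i j hm
    linarith [hj.2]
  have hle : (Finset.univ.filter (fun j => s(i, j) ∈ M)).card ≤ b i := by
    have h1 := h.1.2 i
    have h2 := sum_ind M i
    rw [sum_ind_card] at h2
    have h3 : (Finset.univ.filter (fun j => s(i, j) ∈ M)).card
      = (M.filter (fun e => i ∈ e)).card := by exact_mod_cast h2
    rw [h3]
    convert h1
  have heq := Finset.eq_of_subset_of_card_le hsub (hle.trans ht)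
  constructor
  · rw [sum_ind_card]
    rw [heq] at ht
    exact_mod_cast le_antisymm hle ht
  · intro j hj
    have : j ∈ (Finset.univ.filter (fun j => s(i, j) ∈ M)) := by simp [hj]
    rw [← heq] at this
    simp only [Finset.mem_filter] at this
    exact this.2.2

theorem util_le (h : IsBSolution G b w M p) (i j : V) (hm : s(i, j) ∈ M) :
    utility G b p i ≤ p i j := by
  apply Real.sSup_le _ (sol_nonneg h i j)
  intro t ht
  rcases le_or_gt t 0 with h0 | h0
  · exact h0.trans (sol_nonneg h i j)
  · exact (util_pos_aux h i t h0 ht).2 j hm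

theorem util_pos (h : IsBSolution G b w M p) (i : V) (hu : 0 < utility G b p i) :
    ∑ j, ind M i j = b i := by
  by_contra hne
  apply absurd hu
  rw [not_lt]
  apply Real.sSup_nonpos
  intro t ht
  by_contra h0
  exact hne (util_pos_aux h i t (not_le.1 h0) ht).1

theorem stable_opt (hb : ∀ i, 0 < b i) (h : IsBStable G b w M p) (f : Sym2 V → ℝ)
    (hf : IsFractionalBMatching G b f) : fWeight w f ≤ mWeight w M := by
  obtain ⟨hs, hst⟩ := h
  set u := utility G b p with hu
  have h1 : ∀ i j, w s(i, j) * f s(i, j) ≤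
      (u i * f s(i, j) + u j * f s(i, j)) + (w s(i, j) * ind M i j
        - (u i * ind M i j + u j * ind M i j)) := by
    intro i j
    have hf2 := hf.2.1 s(i, j)
    by_cases hm : s(i, j) ∈ M
    · have a1 := util_le hs i j hm
      have a2 := util_le hs j i (by rwa [Sym2.eq_swap])
      have a3 := (hs.2.1 i j hm).2.2
      rw [← hu] at a1 a2
      rw [ind_mem hm]
      nlinarith [mul_nonneg (sub_nonneg.2 hf2.2) (by linarith : 0 ≤ w s(i, j) - u i - u j)]
    · rw [ind_not_mem hm]
      by_cases ha : G.Adj i j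
      · have := hst i j ha hm
        nlinarith [mul_le_mul_of_nonneg_right this hf2.1]
      · rw [hf.1 s(i, j) (by simpa using ha)]; simp
  have h2 := Finset.sum_le_sum fun i (_ : i ∈ Finset.univ) =>
    Finset.sum_le_sum fun j (_ : j ∈ Finset.univ) => h1 i j
  rw [sum_fWeight G f hf.1 w] at h2
  simp only [Finset.sum_add_distrib, Finset.sum_sub_distrib] at h2
  rw [sum_mWeight G M hs.1.1 w] at h2
  have c1 : ∑ i, ∑ j, u j * f s(i, j) = ∑ i, ∑ j, u i * f s(i, j) := by
    rw [Finset.sum_comm]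
    simp_rw [Sym2.eq_swap]
  have c2 : ∑ i, ∑ j, u j * ind M i j = ∑ i, ∑ j, u i * ind M i j := by
    rw [Finset.sum_comm]
    refine Finset.sum_congr rfl fun i _ => Finset.sum_congr rfl fun j _ => by rw [ind_comm]
  rw [c1, c2] at h2
  have h3 : ∑ i, ∑ j, u i * f s(i, j) ≤ ∑ i, ∑ j, u i * ind M i j := by
    refine Finset.sum_le_sum fun i _ => ?_
    rw [← Finset.mul_sum, ← Finset.mul_sum]
    have hn := util_nonneg hb hs i
    rw [← hu] at hn
    rcases hn.eq_or_lt with h0 | h0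
    · rw [← h0]; simp
    · rw [util_pos hs i h0]
      apply mul_le_mul_of_nonneg_left _ hn
      rw [← sum_incident]
      convert hf.2.2 i
  linarith


/-- arcs of the auxiliary digraph (bipartite double cover plus a root). -/
def arcR (G : SimpleGraph V) (M : Finset (Sym2 V)) (U : V → Prop) :
    Option (V ⊕ V) → Option (V ⊕ V) → Prop
  | some (Sum.inl i), some (Sum.inr j) => G.Adj i j ∧ s(i, j) ∉ M
  | some (Sum.inr j), some (Sum.inl i) => s(i, j) ∈ M
  | some (Sum.inl i), some (Sum.inl j) => i = j
  | some (Sum.inr i), some (Sum.inr j) => i = j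
  | none, some (Sum.inl i) => U i
  | none, some (Sum.inr _) => True
  | some (Sum.inl _), none => True
  | some (Sum.inr j), none => U j
  | none, none => True

/-- costs of the arcs of the auxiliary digraph. -/
def arcC (w : Sym2 V → ℝ) : Option (V ⊕ V) → Option (V ⊕ V) → ℝ
  | some (Sum.inl i), some (Sum.inr j) => - w s(i, j)
  | some (Sum.inr j), some (Sum.inl i) => w s(i, j)
  | _, _ => 0

/-- indicator of a proposition. -/
noncomputable def pind (P : Prop) : ℝ := if P then 1 else 0

theorem pind_true {P : Prop} (h : P) : pind P = 1 := by simp [pind, h]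
theorem pind_false {P : Prop} (h : ¬ P) : pind P = 0 := by simp [pind, h]
theorem pind_nonneg (P : Prop) : 0 ≤ pind P := by unfold pind; split_ifs <;> norm_num

theorem sum_pind_eq (i : V) (g : V → ℝ) : ∑ j, g j * pind (i = j) = g i := by
  unfold pind; simp

theorem sum_pind_le (F : V → Option (V ⊕ V)) (hF : Function.Injective F)
    (y : Option (V ⊕ V)) : ∑ j, pind (y = F j) ≤ 1 := by
  by_cases h : ∃ j, y = F j
  · obtain ⟨j, rfl⟩ := h
    have := sum_pind_eq j (fun _ => 1)
    simp only [one_mul] at this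
    simp only [hF.eq_iff]
    rw [this]
  · push Not at h
    rw [Finset.sum_eq_zero fun j _ => pind_false (h j)]; norm_num

theorem sum_pind_one (F : V → Option (V ⊕ V)) (hF : Function.Injective F)
    (k : V) : ∑ j, pind (F k = F j) = 1 := by
  have := sum_pind_eq k (fun _ => 1)
  simp only [one_mul] at this
  simp only [hF.eq_iff]
  exact this

theorem inl_inj : Function.Injective (fun i : V => (some (Sum.inl i) : Option (V ⊕ V))) := by
  intro a b h; simpa using h
theorem inr_inj : Function.Injective (fun i : V => (some (Sum.inr i) : Option (V ⊕ V))) := by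
  intro a b h; simpa using h

theorem cost_inl (i : V) (y : Option (V ⊕ V)) :
    arcC w (some (Sum.inl i)) y = ∑ j, (- w s(i, j)) * pind (y = some (Sum.inr j)) := by
  rcases y with _ | k | k
  · simp [arcC, pind]
  · simp [arcC, pind]
  · have := sum_pind_eq k (fun j => - w s(i, j))
    simp only [Option.some.injEq, Sum.inr.injEq]
    rw [this]; rfl

theorem cost_inr (j : V) (y : Option (V ⊕ V)) :
    arcC w (some (Sum.inr j)) y = ∑ i, w s(i, j) * pind (y = some (Sum.inl i)) := by
  rcases y with _ | k | k
  · simp [arcC, pind]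
  · have := sum_pind_eq k (fun i => w s(i, j))
    simp only [Option.some.injEq, Sum.inl.injEq]
    rw [this]; rfl
  · simp [arcC, pind]

theorem perm_nonneg (hM : IsBMatching G b M)
    (hopt : ∀ f, IsHalfBMatching G b f → fWeight w f ≤ mWeight w M)
    (σ : Equiv.Perm (Option (V ⊕ V)))
    (hσ : ∀ x, arcR G M (fun i => (∑ j, ind M i j) + 1 ≤ (b i : ℝ)) x (σ x)) :
    0 ≤ ∑ x, arcC w x (σ x) := by
  obtain ⟨A, hA⟩ : ∃ A : V → V → ℝ, ∀ i j,
    A i j = pind (σ (some (Sum.inl i)) = some (Sum.inr j)) := ⟨_, fun _ _ => rfl⟩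
  obtain ⟨B, hB⟩ : ∃ B : V → V → ℝ, ∀ i j,
    B i j = pind (σ (some (Sum.inr j)) = some (Sum.inl i)) := ⟨_, fun _ _ => rfl⟩
  have hA0 : ∀ i j, 0 ≤ A i j := fun i j => by rw [hA]; exact pind_nonneg _
  have hB0 : ∀ i j, 0 ≤ B i j := fun i j => by rw [hB]; exact pind_nonneg _
  have hdeg : ∀ i, ∑ j, ind M i j ≤ (b i : ℝ) := by
    intro i
    rw [sum_ind]
    have := hM.2 i
    exact_mod_cast (by convert this)
  have hX : ∀ i j, (ind M i j - B i j + A i j = 0 ∨ ind M i j - B i j + A i j = 1) ∧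
      (¬ G.Adj i j → ind M i j - B i j + A i j = 0) := by
    intro i j
    have hB1 : s(i, j) ∉ M → B i j = 0 := by
      intro h
      rw [hB]; apply pind_false
      intro h'
      have := hσ (some (Sum.inr j))
      rw [h'] at this
      exact h this
    have hA1 : ¬ (G.Adj i j ∧ s(i, j) ∉ M) → A i j = 0 := by
      intro h
      rw [hA]; apply pind_false
      intro h'
      have := hσ (some (Sum.inl i))
      rw [h'] at this
      exact h this
    by_cases hm : s(i, j) ∈ M
    · have hadj : G.Adj i j := by simpa using hM.1 _ hm
      rw [ind_mem hm, hA1 (fun h => h.2 hm), hB]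
      refine ⟨?_, fun h => absurd hadj h⟩
      unfold pind; split_ifs <;> norm_num
    · rw [ind_not_mem hm, hB1 hm]
      constructor
      · rw [hA]; unfold pind; split_ifs <;> norm_num
      · intro h; rw [hA1 (fun h' => h h'.1)]; norm_num
  have hrow : ∀ i, ∑ j, (ind M i j - B i j + A i j) ≤ (b i : ℝ) := by
    intro i
    rw [Finset.sum_add_distrib, Finset.sum_sub_distrib]
    have a1 : ∑ j, A i j ≤ 1 := by
      simp only [hA]
      exact sum_pind_le _ inr_inj _
    have b0 : 0 ≤ ∑ j, B i j := Finset.sum_nonneg fun j _ => hB0 i j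
    have hd := hdeg i
    obtain ⟨y, hy⟩ : ∃ y, σ y = some (Sum.inl i) := σ.surjective _
    have hr := hσ y
    rw [hy] at hr
    rcases y with _ | k | k
    · have hr : (∑ j, ind M i j) + 1 ≤ (b i : ℝ) := hr
      linarith
    · have hr : k = i := hr
      subst hr
      have : ∑ j, A k j = 0 := Finset.sum_eq_zero fun j _ => by
        rw [hA]; apply pind_false; rw [hy]; simp
      linarith
    · have : 1 ≤ ∑ j, B i j := by
        have h1 : B i k = 1 := by rw [hB]; exact pind_true hy
        rw [← h1]
        exact Finset.single_le_sum (fun j _ => hB0 i j) (Finset.mem_univ k)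
      linarith
  have hcol : ∀ j, ∑ i, (ind M i j - B i j + A i j) ≤ (b j : ℝ) := by
    intro j
    rw [Finset.sum_add_distrib, Finset.sum_sub_distrib]
    have a1 : ∑ i, A i j ≤ 1 := by
      have := sum_pind_le _ inl_inj (σ.symm (some (Sum.inr j)))
      refine le_trans (le_of_eq ?_) this
      refine Finset.sum_congr rfl fun i _ => ?_
      rw [hA]; congr 1
      rw [Equiv.symm_apply_eq]; exact propext eq_comm
    have b0 : 0 ≤ ∑ i, B i j := Finset.sum_nonneg fun i _ => hB0 i j
    have hd := hdeg j
    have hc : ∑ i, ind M i j = ∑ i, ind M j i := Finset.sum_congr rfl fun i _ => ind_comm _ _ _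
    rw [hc]
    have hr := hσ (some (Sum.inr j))
    obtain ⟨y, hy⟩ : ∃ y, σ (some (Sum.inr j)) = y := ⟨_, rfl⟩
    rw [hy] at hr
    rcases y with _ | k | k
    · have hr : (∑ i, ind M j i) + 1 ≤ (b j : ℝ) := hr
      linarith
    · have : 1 ≤ ∑ i, B i j := by
        have h1 : B k j = 1 := by rw [hB]; exact pind_true hy
        rw [← h1]
        exact Finset.single_le_sum (f := fun i => B i j) (fun i _ => hB0 i j) (Finset.mem_univ k)
      linarith
    · have hr : j = k := hr
      subst hr
      have : ∑ i, A i j = 0 := Finset.sum_eq_zero fun i _ => by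
        rw [hA]; apply pind_false; intro h'
        have := σ.injective (h'.trans hy.symm)
        simp at this
      linarith
  obtain ⟨X, hXd⟩ : ∃ X : V → V → ℝ, ∀ i j, X i j = ind M i j - B i j + A i j :=
    ⟨_, fun _ _ => rfl⟩
  simp only [← hXd] at hX hrow hcol
  obtain ⟨f, hf⟩ : ∃ f : Sym2 V → ℝ, ∀ i j, f s(i, j) = (X i j + X j i) / 2 :=
    ⟨Sym2.lift ⟨fun i j => (X i j + X j i) / 2, fun i j => by simp only [add_comm]⟩, fun _ _ => rfl⟩
  have hfhalf : ∀ e, f e = 0 ∨ f e = 1 / 2 ∨ f e = 1 := by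
    intro e
    induction e with
    | _ i j =>
      rw [hf]
      rcases (hX i j).1 with h1 | h1 <;> rcases (hX j i).1 with h2 | h2 <;> rw [h1, h2] <;> norm_num
  have hf0 : ∀ e, e ∉ G.edgeSet → f e = 0 := by
    intro e
    induction e with
    | _ i j =>
      intro h
      have h' : ¬ G.Adj i j := by simpa using h
      rw [hf, (hX i j).2 h', (hX j i).2 (fun h => h' h.symm)]; norm_num
  have hhalf : IsHalfBMatching G b f := by
    refine ⟨⟨hf0, ?_, ?_⟩, hfhalf⟩
    · intro e
      rcases hfhalf e with h | h | h <;> rw [h] <;> norm_num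
    · intro i
      have h1 := sum_incident f i
      have h2 : ∑ j, f s(i, j) ≤ (b i : ℝ) := by
        simp only [hf]
        rw [← Finset.sum_div, Finset.sum_add_distrib]
        linarith [hrow i, hcol i]
      rw [← h1] at h2
      convert h2
  have hfin := hopt f hhalf
  have e1 := sum_fWeight G f hf0 w
  have e2 := sum_mWeight G M hM.1 w
  have e3 : ∑ i, ∑ j, w s(i, j) * f s(i, j) = ∑ i, ∑ j, w s(i, j) * X i j := by
    have hsw : ∑ i, ∑ j, w s(i, j) * X j i = ∑ i, ∑ j, w s(i, j) * X i j := by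
      rw [Finset.sum_comm]
      refine Finset.sum_congr rfl fun i _ => Finset.sum_congr rfl fun j _ => ?_
      rw [Sym2.eq_swap]
    have : ∑ i, ∑ j, w s(i, j) * f s(i, j) =
        (∑ i, ∑ j, w s(i, j) * X i j + ∑ i, ∑ j, w s(i, j) * X j i) / 2 := by
      rw [← Finset.sum_add_distrib, Finset.sum_div]
      refine Finset.sum_congr rfl fun i _ => ?_
      rw [← Finset.sum_add_distrib, Finset.sum_div]
      refine Finset.sum_congr rfl fun j _ => ?_
      rw [hf]; ring
    rw [this, hsw]; ring
  have e4 : ∑ i, ∑ j, w s(i, j) * X i j = ∑ i, ∑ j, w s(i, j) * ind M i j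
      - ∑ i, ∑ j, w s(i, j) * B i j + ∑ i, ∑ j, w s(i, j) * A i j := by
    simp only [hXd, mul_add, mul_sub, Finset.sum_add_distrib, Finset.sum_sub_distrib]
  rw [Fintype.sum_option, Fintype.sum_sum_type]
  have e5 : arcC w none (σ none) = 0 := rfl
  simp only [cost_inl, cost_inr, ← hA, ← hB, neg_mul, Finset.sum_neg_distrib]
  have e6 : ∑ j, ∑ i, w s(i, j) * B i j = ∑ i, ∑ j, w s(i, j) * B i j := Finset.sum_comm
  rw [e5, e6]
  linarith

theorem opt_stable (hb : ∀ i, 0 < b i) (hM : IsBMatching G b M)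
    (hopt : ∀ f, IsHalfBMatching G b f → fWeight w f ≤ mWeight w M) :
    ∃ p, IsBStable G b w M p := by
  obtain ⟨π, hπ⟩ := exists_potential
    (arcR G M (fun i => (∑ j, ind M i j) + 1 ≤ (b i : ℝ))) (arcC w)
    (by rintro (_ | i | i) <;> simp [arcR]) (by rintro (_ | i | i) <;> simp [arcC])
    (perm_nonneg hM hopt)
  obtain ⟨y, hy⟩ : ∃ y : V → ℝ, ∀ i, y i = (π (some (Sum.inl i)) - π (some (Sum.inr i))) / 2 :=
    ⟨_, fun _ => rfl⟩
  have hy0 : ∀ i, 0 ≤ y i := by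
    intro i
    have h1 := hπ none (some (Sum.inr i)) trivial
    have h2 := hπ (some (Sum.inl i)) none trivial
    simp only [arcC] at h1 h2
    rw [hy]; linarith
  have hyu : ∀ i, (∑ j, ind M i j) + 1 ≤ (b i : ℝ) → y i = 0 := by
    intro i hi
    have h1 := hπ (some (Sum.inr i)) none hi
    have h2 := hπ none (some (Sum.inl i)) hi
    have h3 := hy0 i
    simp only [arcC] at h1 h2
    rw [hy] at h3 ⊢; linarith
  have hyM : ∀ i j, s(i, j) ∈ M → y i + y j ≤ w s(i, j) := by
    intro i j hm
    have h1 := hπ (some (Sum.inr j)) (some (Sum.inl i)) hm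
    have h2 := hπ (some (Sum.inr i)) (some (Sum.inl j))
      (show s(j, i) ∈ M by rwa [Sym2.eq_swap])
    simp only [arcC] at h1 h2
    rw [Sym2.eq_swap] at h2
    rw [hy, hy]; linarith
  have hyN : ∀ i j, G.Adj i j → s(i, j) ∉ M → w s(i, j) ≤ y i + y j := by
    intro i j ha hm
    have h1 := hπ (some (Sum.inl i)) (some (Sum.inr j)) ⟨ha, hm⟩
    have h2 := hπ (some (Sum.inl j)) (some (Sum.inr i))
      ⟨ha.symm, by rwa [Sym2.eq_swap]⟩
    simp only [arcC] at h1 h2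
    rw [Sym2.eq_swap (a := j)] at h2
    rw [hy, hy]; linarith
  obtain ⟨p, hp⟩ : ∃ p : V → V → ℝ, ∀ i j, p i j =
      pind (s(i, j) ∈ M) * ((w s(i, j) + y i - y j) / 2) := ⟨_, fun _ _ => rfl⟩
  have hpM : ∀ i j, s(i, j) ∈ M → p i j = (w s(i, j) + y i - y j) / 2 := by
    intro i j h; rw [hp, pind_true h, one_mul]
  have hsol : IsBSolution G b w M p := by
    refine ⟨hM, ?_, ?_⟩
    · intro i j hm
      have hm' : s(j, i) ∈ M := by rwa [Sym2.eq_swap]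
      have h1 := hyM i j hm
      have h2 := hy0 i
      have h3 := hy0 j
      rw [hpM i j hm, hpM j i hm', Sym2.eq_swap (a := j)]
      refine ⟨?_, ?_, ?_⟩ <;> linarith
    · intro i j hm
      rw [hp, pind_false hm, zero_mul]
  have hut : ∀ i, y i ≤ utility G b p i := by
    intro i
    by_cases hu : (∑ j, ind M i j) + 1 ≤ (b i : ℝ)
    · rw [hyu i hu]; exact util_nonneg hb hsol i
    · apply le_csSup (util_bdd hb hsol i)
      rw [sum_ind_card] at hu
      have hu' : b i ≤ (Finset.univ.filter (fun j => s(i, j) ∈ M)).card := by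
        by_contra hlt
        push Not at hlt
        exact hu (by exact_mod_cast hlt)
      refine le_trans hu' (Finset.card_le_card ?_)
      intro j hj
      simp only [Finset.mem_filter, Finset.mem_univ, true_and] at hj ⊢
      refine ⟨by simpa using hM.1 _ hj, ?_⟩
      rw [hpM i j hj]
      linarith [hyM i j hj]
  refine ⟨p, hsol, fun i j ha hm => ?_⟩
  linarith [hyN i j ha hm, hut i, hut j]

theorem matching_half (hM : IsBMatching G b M) : IsHalfBMatching G b (eind M) := by
  have h01 : ∀ e, eind M e = 0 ∨ eind M e = 1 := by
    intro e; unfold eind; split_ifs <;> simp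
  refine ⟨⟨?_, ?_, ?_⟩, ?_⟩
  · intro e he
    unfold eind
    rw [if_neg (fun h => he (hM.1 e h))]
  · intro e
    rcases h01 e with h | h <;> rw [h] <;> norm_num
  · intro i
    have h1 := sum_ind M i
    have h2 := sum_incident (eind M) i
    have h3 := hM.2 i
    have h4 : ∑ j, ind M i j ≤ (b i : ℝ) := by
      rw [h1]
      exact_mod_cast (by convert h3)
    unfold ind at h4
    rw [← h2] at h4
    convert h4
  · intro e
    rcases h01 e with h | h <;> rw [h] <;> norm_num

theorem fWeight_eind : fWeight w (eind M) = mWeight w M := by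
  simp [fWeight, mWeight, eind]

theorem half_bdd : BddAbove {t | ∃ f : Sym2 V → ℝ, IsHalfBMatching G b f ∧ t = fWeight w f} := by
  refine ⟨∑ e : Sym2 V, |w e|, ?_⟩
  rintro t ⟨f, hf, rfl⟩
  refine Finset.sum_le_sum fun e _ => ?_
  have := hf.1.2.1 e
  nlinarith [abs_nonneg (w e), le_abs_self (w e), mul_le_mul_of_nonneg_right (le_abs_self (w e)) this.1]

theorem bVal_mem (G : SimpleGraph V) (b : V → ℕ) (w : Sym2 V → ℝ) :
    (∃ M, IsBMatching G b M ∧ bVal G b w Finset.univ = mWeight w M) ∧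
      ∀ M, IsBMatching G b M → mWeight w M ≤ bVal G b w Finset.univ := by
  have hfin : {t | ∃ M : Finset (Sym2 V), IsBMatching G b M ∧ EdgesIn Finset.univ M ∧
      t = mWeight w M}.Finite := by
    refine (Set.finite_range (fun M : Finset (Sym2 V) => mWeight w M)).subset ?_
    rintro t ⟨M, _, _, rfl⟩
    exact ⟨M, rfl⟩
  constructor
  · have hne : {t | ∃ M : Finset (Sym2 V), IsBMatching G b M ∧ EdgesIn Finset.univ M ∧
        t = mWeight w M}.Nonempty :=
      ⟨_, ∅, ⟨by simp, by simp⟩, by simp [EdgesIn], rfl⟩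
    obtain ⟨M, hM, _, h⟩ := hne.csSup_mem hfin
    exact ⟨M, hM, h⟩
  · intro M hM
    exact le_csSup hfin.bddAbove ⟨M, hM, fun _ _ _ _ => Finset.mem_univ _, rfl⟩

end Util

/-- an instance `(G,b,w)` of Stable Fixtures with Payments has a stable
solution if and only if the maximum weight of a `b`-matching of `G` equals the maximum
weight of a half-`b`-matching of `G`. -/
theorem statement10 [Fintype V] [DecidableEq V] (G : SimpleGraph V) (b : V → ℕ)
    (hb : ∀ i, 0 < b i) (w : Sym2 V → ℝ) (hw : ∀ e ∈ G.edgeSet, 0 < w e) :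
    (∃ (M : Finset (Sym2 V)) (p : V → V → ℝ), IsBStable G b w M p) ↔
      bVal G b w Finset.univ =
        sSup {t | ∃ f : Sym2 V → ℝ, IsHalfBMatching G b f ∧ t = fWeight w f} := by
  obtain ⟨⟨M₀, hM₀, hv⟩, hmax⟩ := bVal_mem G b w
  constructor
  · rintro ⟨M, p, h⟩
    apply le_antisymm
    · rw [hv, ← fWeight_eind]
      exact le_csSup half_bdd ⟨_, matching_half hM₀, rfl⟩
    · refine csSup_le ⟨_, _, matching_half hM₀, rfl⟩ ?_
      rintro t ⟨f, hf, rfl⟩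
      exact (stable_opt hb h f hf.1).trans (hmax M h.1.1)
  · intro h
    refine ⟨M₀, opt_stable hb hM₀ fun f hf => ?_⟩
    rw [← hv, h]
    exact le_csSup half_bdd ⟨f, hf, rfl⟩

end MatchingGames
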